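/- arXiv:2402.07021 — 2 statements merged into one kernel-verified Lean document; each statement's English description precedes it below -/
import Mathlib

section
/- Let ρ ∈ ℝ, m ≥ 1, and for i = 1,…,m let μ_i ∈ ℝ and σ_i > 0. Let ν be the mixture measure ν = (1/m)·Σ_{i=1}^m N(μ_i, σ_i²) on ℝ. Then ∫ max(0, ρ − y) dν(y) = (1/m)·Σ_{i=1}^m [(ρ − μ_i)·Φ(z_i) + σ_i·φ(z_i)], where z_i = (ρ − μ_i)/σ_i. -/
open MeasureTheory ProbabilityTheory
open scoped ENNReal

/-- The standard normal probability density function. -/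
noncomputable def stdNormalPDF (z : ℝ) : ℝ := Real.exp (-z ^ 2 / 2) / Real.sqrt (2 * Real.pi)

/-- The standard normal cumulative distribution function. -/
noncomputable def stdNormalCDF (z : ℝ) : ℝ := ∫ t in Set.Iic z, stdNormalPDF t

lemma stdNormalPDF_eq_gaussianPDFReal : stdNormalPDF = gaussianPDFReal 0 1 := by
  ext x
  simp [stdNormalPDF, gaussianPDFReal, div_eq_inv_mul]

lemma integrable_stdNormalPDF : Integrable stdNormalPDF := by
  rw [stdNormalPDF_eq_gaussianPDFReal]
  exact integrable_gaussianPDFReal 0 1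

lemma integrable_mul_stdNormalPDF : Integrable (fun x ↦ x * stdNormalPDF x) := by
  have h := (integrable_mul_exp_neg_mul_sq (b := 1 / 2) (by norm_num)).div_const
    (Real.sqrt (2 * Real.pi))
  refine h.congr (.of_forall fun x ↦ ?_)
  simp only [stdNormalPDF]
  rw [← mul_div_assoc]
  ring_nf

lemma hasDerivAt_neg_stdNormalPDF (x : ℝ) :
    HasDerivAt (fun x ↦ -stdNormalPDF x) (x * stdNormalPDF x) x := by
  have h := (((((hasDerivAt_id x).pow 2).neg.div_const 2).exp).div_const
    (Real.sqrt (2 * Real.pi))).neg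
  refine h.congr_deriv ?_
  simp [stdNormalPDF]
  ring

lemma tendsto_stdNormalPDF_atBot : Filter.Tendsto stdNormalPDF Filter.atBot (nhds 0) := by
  have h : Filter.Tendsto (fun x : ℝ ↦ -x ^ 2 / 2) Filter.atBot Filter.atBot := by
    refine Filter.Tendsto.atBot_div_const (by norm_num) ?_
    refine Filter.tendsto_neg_atTop_atBot.comp ?_
    simpa only [sq, id] using Filter.tendsto_id.atBot_mul_atBot₀ Filter.tendsto_id
  have h' := (Real.tendsto_exp_atBot.comp h).div_const (Real.sqrt (2 * Real.pi))
  rw [zero_div] at h'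
  exact h'

lemma integral_Iic_mul_stdNormalPDF (z : ℝ) :
    ∫ x in Set.Iic z, x * stdNormalPDF x = -stdNormalPDF z := by
  have h := tendsto_stdNormalPDF_atBot.neg
  rw [neg_zero] at h
  simpa using integral_Iic_of_hasDerivAt_of_tendsto' (fun x _ ↦ hasDerivAt_neg_stdNormalPDF x)
    integrable_mul_stdNormalPDF.integrableOn h

/-- Expected improvement of a standard normal variable over the target `z`. -/
lemma integral_max_zero_sub_gaussianReal_zero_one (z : ℝ) :
    ∫ x, max 0 (z - x) ∂(gaussianReal 0 1) = z * stdNormalCDF z + stdNormalPDF z := by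
  rw [integral_gaussianReal_eq_integral_smul one_ne_zero, ← stdNormalPDF_eq_gaussianPDFReal]
  have h : (fun x ↦ stdNormalPDF x • max 0 (z - x)) =
      (Set.Iic z).indicator (fun x ↦ z * stdNormalPDF x - x * stdNormalPDF x) := by
    ext x
    by_cases hx : x ≤ z
    · rw [Set.indicator_of_mem (Set.mem_Iic.2 hx), max_eq_right (sub_nonneg.2 hx), smul_eq_mul]
      ring
    · rw [Set.indicator_of_notMem (by simpa using hx),
        max_eq_left (sub_nonpos.2 (not_le.1 hx).le), smul_zero]
  rw [h, integral_indicator measurableSet_Iic,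
    integral_sub (integrable_stdNormalPDF.const_mul z).integrableOn
      integrable_mul_stdNormalPDF.integrableOn,
    integral_const_mul, integral_Iic_mul_stdNormalPDF, sub_neg_eq_add, stdNormalCDF]

/-- Expected improvement of a normal variable over the target `ρ`. -/
lemma integral_max_zero_sub_gaussianReal (ρ μ : ℝ) {σ : ℝ} (hσ : 0 < σ) :
    ∫ y, max 0 (ρ - y) ∂(gaussianReal μ (Real.toNNReal (σ ^ 2))) =
      (ρ - μ) * stdNormalCDF ((ρ - μ) / σ) + σ * stdNormalPDF ((ρ - μ) / σ) := by
  have hmap : gaussianReal μ (Real.toNNReal (σ ^ 2)) =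
      (gaussianReal 0 1).map (fun x ↦ μ + σ * x) := by
    change _ = (gaussianReal 0 1).map ((fun x ↦ μ + x) ∘ fun x ↦ σ * x)
    rw [← Measure.map_map (by fun_prop) (by fun_prop),
      gaussianReal_map_const_mul, gaussianReal_map_const_add]
    congr 1
    · simp
    · ext
      simp [sq_nonneg]
  rw [hmap, integral_map (by fun_prop) (by fun_prop)]
  have h (x : ℝ) : max 0 (ρ - (μ + σ * x)) = σ * max 0 ((ρ - μ) / σ - x) := by
    rw [mul_max_of_nonneg _ _ hσ.le, mul_zero, mul_sub, mul_div_cancel₀ _ hσ.ne', sub_sub]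
  simp_rw [h]
  rw [integral_const_mul, integral_max_zero_sub_gaussianReal_zero_one, mul_add, ← mul_assoc,
    mul_div_cancel₀ _ hσ.ne']

lemma integrable_max_zero_sub_gaussianReal (ρ μ : ℝ) (v : NNReal) :
    Integrable (fun y ↦ max 0 (ρ - y)) (gaussianReal μ v) := by
  have hid : Integrable (fun y : ℝ ↦ y) (gaussianReal μ v) :=
    (memLp_id_gaussianReal' (μ := μ) (v := v) 1 (by simp)).integrable le_rfl
  exact (integrable_zero _ _ _).sup ((integrable_const ρ).sub hid)

/-- Expected improvement under an equally-weighted mixture of Gaussians: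
`∫ max(0, ρ − y) dν = (1/m)·Σᵢ [(ρ − μᵢ)·Φ(zᵢ) + σᵢ·φ(zᵢ)]` with `zᵢ = (ρ − μᵢ)/σᵢ`. -/
theorem expected_improvement_gaussian_mixture (ρ : ℝ) (m : ℕ) (hm : 1 ≤ m)
    (μ σ : Fin m → ℝ) (hσ : ∀ i, 0 < σ i) :
    ∫ y, max 0 (ρ - y)
        ∂((m : ℝ≥0∞)⁻¹ • ∑ i : Fin m, gaussianReal (μ i) (Real.toNNReal ((σ i) ^ 2))) =
      (1 / (m : ℝ)) * ∑ i : Fin m,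
        ((ρ - μ i) * stdNormalCDF ((ρ - μ i) / σ i) + σ i * stdNormalPDF ((ρ - μ i) / σ i)) := by
  rw [integral_smul_measure, integral_finsetSum_measure
    fun i _ ↦ integrable_max_zero_sub_gaussianReal ρ (μ i) _]
  simp [integral_max_zero_sub_gaussianReal _ _ (hσ _)]
end

section
/- Fix ρ, μ ∈ ℝ. The function σ ↦ (ρ − μ)·Φ((ρ − μ)/σ) + σ·φ((ρ − μ)/σ) is strictly monotonically increasing on (0, ∞). In particular, for two Gaussian predictions with the same mean, the one with larger predictive standard deviation has strictly larger expected improvement. -/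
theorem stdNormalPDF_pos (z : ℝ) : 0 < stdNormalPDF z := by
  unfold stdNormalPDF
  positivity

theorem continuous_stdNormalPDF : Continuous stdNormalPDF := by
  unfold stdNormalPDF
  fun_prop

theorem integrable_stdNormalPDF_s5 : MeasureTheory.Integrable stdNormalPDF := by
  refine ((integrable_exp_neg_mul_sq (b := 1 / 2) (by norm_num)).div_const
    (Real.sqrt (2 * Real.pi))).congr (Filter.Eventually.of_forall fun z => ?_)
  simp only [stdNormalPDF]
  ring_nf

theorem hasDerivAt_stdNormalPDF (z : ℝ) :
    HasDerivAt stdNormalPDF (-z * stdNormalPDF z) z := by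
  have h : HasDerivAt (fun z : ℝ => -z ^ 2 / 2) (-z) z := by
    refine ((hasDerivAt_pow 2 z).neg.div_const 2).congr_deriv ?_
    norm_num
    ring
  refine (h.exp.div_const (Real.sqrt (2 * Real.pi))).congr_deriv ?_
  simp only [stdNormalPDF]
  ring

theorem hasDerivAt_stdNormalCDF (z : ℝ) :
    HasDerivAt stdNormalCDF (stdNormalPDF z) z := by
  have h : HasDerivAt (fun x => stdNormalCDF 0 + ∫ t in (0 : ℝ)..x, stdNormalPDF t)
      (stdNormalPDF z) z :=
    (continuous_stdNormalPDF.integral_hasStrictDerivAt 0 z).hasDerivAt.const_add _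
  refine h.congr_of_eventuallyEq (Filter.Eventually.of_forall fun x => ?_)
  have hx := intervalIntegral.integral_Iic_sub_Iic
    (integrable_stdNormalPDF_s5.integrableOn (s := Set.Iic 0))
    (integrable_stdNormalPDF_s5.integrableOn (s := Set.Iic x))
  simp only [stdNormalCDF]
  linarith

/-- The derivative of the expected improvement in `σ` is the density at the standardized gap. -/
theorem hasDerivAt_expected_improvement (a : ℝ) {σ : ℝ} (hσ : σ ≠ 0) :
    HasDerivAt (fun σ : ℝ => a * stdNormalCDF (a / σ) + σ * stdNormalPDF (a / σ))
      (stdNormalPDF (a / σ)) σ := by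
  have hz : HasDerivAt (fun σ : ℝ => a / σ) (-a / σ ^ 2) σ := by
    refine ((hasDerivAt_const σ a).div (hasDerivAt_id σ) hσ).congr_deriv ?_
    simp
  have hcdf := ((hasDerivAt_stdNormalCDF (a / σ)).comp σ hz).const_mul a
  have hpdf := (hasDerivAt_id σ).mul ((hasDerivAt_stdNormalPDF (a / σ)).comp σ hz)
  refine (hcdf.add hpdf).congr_deriv ?_
  simp only [id, Function.comp_apply]
  field_simp
  ring

/-- For fixed `ρ, μ`, the expected improvement is strictly increasing in the predictive
standard deviation `σ` on `(0, ∞)`. -/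
theorem expected_improvement_strictMonoOn (ρ μ : ℝ) :
    StrictMonoOn
      (fun σ : ℝ => (ρ - μ) * stdNormalCDF ((ρ - μ) / σ) + σ * stdNormalPDF ((ρ - μ) / σ))
      (Set.Ioi 0) := by
  have h : ∀ σ ∈ Set.Ioi (0 : ℝ), HasDerivAt
      (fun σ : ℝ => (ρ - μ) * stdNormalCDF ((ρ - μ) / σ) + σ * stdNormalPDF ((ρ - μ) / σ))
      (stdNormalPDF ((ρ - μ) / σ)) σ :=
    fun σ hσ => hasDerivAt_expected_improvement (ρ - μ) (ne_of_gt hσ)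
  refine strictMonoOn_of_hasDerivWithinAt_pos (convex_Ioi 0)
    (fun σ hσ => (h σ hσ).continuousAt.continuousWithinAt)
    (fun σ hσ => (h σ (interior_subset hσ)).hasDerivWithinAt)
    (fun σ _ => stdNormalPDF_pos _)
end
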